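/- Let η ≠ 0, β ∈ ℂ, N ≥ 2, and let ū = (u_1,…,u_N) and v̄ = (v_1,…,v_{N−1}) be tuples of complex numbers such that: the u_j are pairwise distinct, the v_j are pairwise distinct, u_k ≠ v_j for all j, k, u_a − u_b ∉ {η, −η} for a ≠ b, and u_k − v_j ∉ {η, −η} for all j, k. Define, for any n-tuple ū and (n−1)-tuple v̄ satisfying these conditions, Ψ_n(v̄,ū|β) = Δ'(v̄) Δ(ū) h(ū,v̄) · det_n M, where M_{jk} = e^β t(u_k,v_j) − t(v_j,u_k) · h(u_k,ū) h(v̄,u_k) / (h(ū,u_k) h(u_k,v̄)) for 1 ≤ j ≤ n−1 and M_{nk} = h(u_k,ū)/h(u_k,v̄). Then Ψ_N(v̄,ū|β) = Σ_{j=1}^{N} g(u_j,v_{N−1}) · [ e^β f(ū_j,u_j) f(u_j,v̄_{N−1}) − f(u_j,ū_j) f(v̄_{N−1},u_j) ] · Ψ_{N−1}(v̄_{N−1}, ū_j | β), where ū_j denotes ū with u_j removed and v̄_{N−1} denotes v̄ with v_{N−1} removed. -/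

import Mathlib

open Finset

noncomputable section


/-- `g(u,v) = η/(u−v)` -/
def gg (η u v : ℂ) : ℂ := η / (u - v)

/-- `f(u,v) = (u−v+η)/(u−v)` -/
def ff (η u v : ℂ) : ℂ := (u - v + η) / (u - v)

/-- `h(u,v) = (u−v+η)/η` -/
def hh (η u v : ℂ) : ℂ := (u - v + η) / η

/-- `t(u,v) = η²/((u−v)(u−v+η))` -/
def tt (η u v : ℂ) : ℂ := η ^ 2 / ((u - v) * (u - v + η))

/-- `Δ(w̄) = Π_{j<k} g(w_k,w_j)` -/
def Delta (η : ℂ) {n : ℕ} (w : Fin n → ℂ) : ℂ :=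
  ∏ j : Fin n, ∏ k ∈ Finset.univ.filter (fun k => j < k), gg η (w k) (w j)

/-- `Δ'(w̄) = Π_{j<k} g(w_j,w_k)` -/
def Delta' (η : ℂ) {n : ℕ} (w : Fin n → ℂ) : ℂ :=
  ∏ j : Fin n, ∏ k ∈ Finset.univ.filter (fun k => j < k), gg η (w j) (w k)

/-- The highest coefficient `K_N(v̄|ū)`. -/
def Kc (η : ℂ) (N : ℕ) (v u : Fin N → ℂ) : ℂ :=
  Delta' η v * Delta η u * (∏ j, ∏ k, hh η (v j) (u k)) *
    Matrix.det (Matrix.of fun j k : Fin N => tt η (v j) (u k))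

/-- The `m`-tuple of values of `w` on the finset `S`, listed in increasing index order
(meaningful when `S.card = m`). -/
def subT {n : ℕ} (w : Fin n → ℂ) (S : Finset (Fin n)) (m : ℕ) : Fin m → ℂ :=
  fun i => ((S.sort (· ≤ ·)).map w).getD i 0

/-- The field form-factor function: `Psi η β m v u` corresponds to `Ψ_{m+1}(v̄,ū|β)`
with an `m`-tuple `v̄` and an `(m+1)`-tuple `ū`. -/
def Psi (η β : ℂ) (m : ℕ) (v : Fin m → ℂ) (u : Fin (m + 1) → ℂ) : ℂ :=
  Delta' η v * Delta η u * (∏ a, ∏ b, hh η (u a) (v b)) *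
    Matrix.det (Matrix.of fun j k : Fin (m + 1) =>
      if hj : (j : ℕ) < m then
        Complex.exp β * tt η (u k) (v ⟨j, hj⟩) -
          tt η (v ⟨j, hj⟩) (u k) * ((∏ a, hh η (u k) (u a)) * ∏ a, hh η (v a) (u k)) /
            ((∏ a, hh η (u a) (u k)) * ∏ a, hh η (u k) (v a))
      else (∏ a, hh η (u k) (u a)) / (∏ a, hh η (u k) (v a)))

/-- A Cauchy-type partial fraction identity: if `∑ k, P k / (u k - X)`, with `deg P k ≤ m`, vanishes
at the `m` zeros of `W = ∏ i, (v i - X)`, then its quotient by `W` is determined by the residues at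
the points `u k`. -/
theorem sum_eval_div_sub_eq {K ι : Type*} [Field K] [Fintype ι] {m : ℕ} (u : ι → K)
    (v : Fin m → K) (hv : Function.Injective v) (huv : ∀ i k, u k ≠ v i)
    (P : ι → Polynomial K) (hP : ∀ k, (P k).natDegree ≤ m)
    (hzero : ∀ i, ∑ k, (P k).eval (v i) / (u k - v i) = 0) (z : K) (hz : ∀ k, u k ≠ z) :
    ∑ k, (P k).eval z / (u k - z) =
      (∏ i, (v i - z)) * ∑ k, (P k).eval (u k) / ((∏ i, (v i - u k)) * (u k - z)) := by
  classical
  set W : Polynomial K := ∏ i, (Polynomial.C (v i) - Polynomial.X) with hW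
  have hWeval : ∀ x, W.eval x = ∏ i, (v i - x) := fun x => by
    simp [hW, Polynomial.eval_prod]
  have hWdeg : W.natDegree ≤ m := by
    refine (Polynomial.natDegree_prod_le _ _).trans ?_
    refine (Finset.sum_le_card_nsmul _ _ 1 fun i _ => ?_).trans (by simp)
    exact (Polynomial.natDegree_sub_le _ _).trans (by simp)
  have hWu : ∀ k, W.eval (u k) ≠ 0 := fun k => by
    rw [hWeval]
    exact Finset.prod_ne_zero_iff.2 fun i _ => sub_ne_zero.2 (huv i k).symm
  have hR : ∀ k, ∃ R : Polynomial K, R.degree < m ∧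
      P k - Polynomial.C ((P k).eval (u k) / W.eval (u k)) * W
        = (Polynomial.X - Polynomial.C (u k)) * R := fun k => by
    set Q := P k - Polynomial.C ((P k).eval (u k) / W.eval (u k)) * W with hQ
    have hroot : Q.IsRoot (u k) := by
      simp [hQ, Polynomial.IsRoot, div_mul_cancel₀ _ (hWu k)]
    obtain ⟨R, hR⟩ := Polynomial.dvd_iff_isRoot.2 hroot
    refine ⟨R, ?_, hR⟩
    have hQdeg : Q.natDegree ≤ m := by
      refine (Polynomial.natDegree_sub_le _ _).trans (max_le (hP k) ?_)
      exact (Polynomial.natDegree_C_mul_le _ _).trans hWdeg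
    by_cases hR0 : R = 0
    · rw [hR0, Polynomial.degree_zero]
      exact WithBot.bot_lt_coe m
    · rw [Polynomial.degree_eq_natDegree hR0]
      rw [hR, Polynomial.natDegree_mul (Polynomial.X_sub_C_ne_zero _) hR0,
        Polynomial.natDegree_X_sub_C] at hQdeg
      exact_mod_cast (by omega : R.natDegree < m)
  choose R hRdeg hR using hR
  have hReval : ∀ x, (∀ k, u k ≠ x) → (∑ k, R k).eval x =
      W.eval x * (∑ k, (P k).eval (u k) / (W.eval (u k) * (u k - x))) -
        ∑ k, (P k).eval x / (u k - x) := fun x hx => by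
    rw [Polynomial.eval_finsetSum, Finset.mul_sum, ← Finset.sum_sub_distrib]
    refine Finset.sum_congr rfl fun k _ => ?_
    have h := congrArg (Polynomial.eval x) (hR k)
    simp only [Polynomial.eval_sub, Polynomial.eval_mul, Polynomial.eval_C, Polynomial.eval_X] at h
    have h1 : u k - x ≠ 0 := sub_ne_zero.2 (hx k)
    have h2 := hWu k
    field_simp at h ⊢
    linear_combination h
  have hR0 : ∑ k, R k = 0 := by
    refine Polynomial.eq_zero_of_degree_lt_of_eval_index_eq_zero (v := v) Finset.univ
      hv.injOn ?_ fun i _ => ?_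
    · rw [Finset.card_univ, Fintype.card_fin]
      exact (Polynomial.degree_sum_le _ _).trans_lt
        ((Finset.sup_lt_iff (WithBot.bot_lt_coe m)).2 fun k _ => hRdeg k)
    · rw [hReval _ (huv i), hzero i, hWeval,
        Finset.prod_eq_zero (Finset.mem_univ i) (sub_self _)]
      simp
  have h := hReval z hz
  rw [hR0, Polynomial.eval_zero] at h
  simp only [hWeval] at h
  exact (sub_eq_zero.1 h.symm).symm

/-- A determinant whose first `m` rows are affine in `z` and whose last row is constant is a
polynomial in `z` of degree at most `m`. -/
theorem exists_polynomial_eval_eq_det {K : Type*} [CommRing K] {m : ℕ}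
    (a b : Fin m → Fin (m + 1) → K) (y : Fin (m + 1) → K) :
    ∃ P : Polynomial K, P.natDegree ≤ m ∧ ∀ z, P.eval z =
      Matrix.det (Matrix.of (Fin.snoc (α := fun _ => Fin (m + 1) → K)
        (fun i l => a i l * z + b i l) y)) := by
  let E : Matrix (Fin (m + 1)) (Fin (m + 1)) (Polynomial K) :=
    Matrix.of (Fin.snoc (α := fun _ => Fin (m + 1) → Polynomial K)
      (fun i l => Polynomial.C (a i l) * Polynomial.X + Polynomial.C (b i l))
      (fun l => Polynomial.C (y l)))
  refine ⟨E.det, ?_, fun z => ?_⟩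
  · let d : Fin (m + 1) → ℕ := Fin.snoc (α := fun _ => ℕ) (fun _ => 1) 0
    have hd : ∀ r l, (E r l).natDegree ≤ d r := fun r l => by
      induction r using Fin.lastCases with
      | last => simp [E, d]
      | cast i => simpa [E, d] using Polynomial.natDegree_linear_le (b := b i l)
    rw [Matrix.det_apply]
    refine Polynomial.natDegree_sum_le_of_forall_le _ _ fun σ _ => ?_
    refine (Polynomial.natDegree_smul_le _ _).trans ?_
    refine (Polynomial.natDegree_prod_le _ _).trans ?_
    refine (Finset.sum_le_sum fun l _ => hd (σ l) l).trans ?_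
    rw [Equiv.sum_comp σ d, Fin.sum_univ_castSucc]
    simp [d]
  · rw [← Polynomial.coe_evalRingHom, RingHom.map_det]
    congr 1
    ext r l
    induction r using Fin.lastCases with
    | last => simp [E]
    | cast i => simp [E]

theorem prod_ite_succAbove_lt {n : ℕ} (p : Fin (n + 1)) :
    (∏ l : Fin n, if p.succAbove l < p then (-1 : ℂ) else 1) = (-1) ^ (p : ℕ) := by
  rw [← Finset.prod_filter, Finset.prod_const]
  congr 1
  have h : (Finset.univ.filter fun l : Fin n => p.succAbove l < p).map Fin.valEmbedding =
      Finset.range p := by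
    ext x
    simp only [Finset.mem_map, Finset.mem_filter, Finset.mem_univ, true_and, Finset.mem_range,
      Fin.succAbove_lt_iff_castSucc_lt, Fin.valEmbedding_apply]
    refine ⟨?_, fun hx => ⟨⟨x, by omega⟩, ?_, rfl⟩⟩
    · rintro ⟨l, hl, rfl⟩
      exact hl
    · exact hx
  rw [← Finset.card_map Fin.valEmbedding, h, Finset.card_range]

theorem gg_swap (η x y : ℂ) : gg η x y = -gg η y x := by
  rw [gg, gg, ← neg_sub y x, div_neg]

theorem Delta_eq_succAbove (η : ℂ) {n : ℕ} (w : Fin (n + 1) → ℂ) (p : Fin (n + 1)) :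
    Delta η w = (-1) ^ (p : ℕ) * (∏ l, gg η (w (p.succAbove l)) (w p)) *
      Delta η (w ∘ p.succAbove) := by
  simp only [Delta, Finset.prod_filter]
  rw [Fin.prod_univ_succAbove _ p, Fin.prod_univ_succAbove _ p]
  simp only [lt_irrefl, if_false, one_mul]
  have h : ∀ l : Fin n, (∏ k, if p.succAbove l < k then gg η (w k) (w (p.succAbove l)) else 1) =
      (if p.succAbove l < p then gg η (w p) (w (p.succAbove l)) else 1) *
        ∏ k, if l < k then gg η ((w ∘ p.succAbove) k) ((w ∘ p.succAbove) l) else 1 := fun l => by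
    rw [Fin.prod_univ_succAbove _ p]
    simp [Fin.succAbove_lt_succAbove_iff]
  rw [Finset.prod_congr rfl fun l _ => h l, Finset.prod_mul_distrib, ← mul_assoc,
    ← prod_ite_succAbove_lt p]
  congr 1
  rw [← Finset.prod_mul_distrib, ← Finset.prod_mul_distrib]
  refine Finset.prod_congr rfl fun l _ => ?_
  rcases lt_or_gt_of_ne (Fin.succAbove_ne p l) with hl | hl
  · simp [hl, hl.not_gt, gg_swap η (w p)]
  · simp [hl, hl.not_gt]

theorem Delta'_eq_castSucc (η : ℂ) {n : ℕ} (w : Fin (n + 1) → ℂ) :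
    Delta' η w = (∏ l : Fin n, gg η (w l.castSucc) (w (Fin.last n))) *
      Delta' η (w ∘ Fin.castSucc) := by
  simp only [Delta', Finset.prod_filter]
  rw [Fin.prod_univ_castSucc, ← Finset.prod_mul_distrib]
  have hlast : (∏ k : Fin (n + 1), if Fin.last n < k then gg η (w (Fin.last n)) (w k) else (1 : ℂ)) = 1 :=
    Finset.prod_eq_one fun k _ => if_neg (Fin.le_last k).not_gt
  rw [hlast, mul_one]
  refine Finset.prod_congr rfl fun l _ => ?_
  rw [Fin.prod_univ_castSucc, mul_comm]
  simp

/-- The ratio `h(u_k,ū) h(v̄,u_k) / (h(ū,u_k) h(u_k,v̄))`. -/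
def ratioX (η : ℂ) {m n : ℕ} (v : Fin m → ℂ) (u : Fin n → ℂ) (k : Fin n) : ℂ :=
  ((∏ a, hh η (u k) (u a)) * ∏ a, hh η (v a) (u k)) /
    ((∏ a, hh η (u a) (u k)) * ∏ a, hh η (u k) (v a))

/-- The ratio `h(u_k,ū) / h(u_k,v̄)`. -/
def ratioY (η : ℂ) {m n : ℕ} (v : Fin m → ℂ) (u : Fin n → ℂ) (k : Fin n) : ℂ :=
  (∏ a, hh η (u k) (u a)) / ∏ a, hh η (u k) (v a)

/-- The first rows of the matrix of `Ψ` with additional parameter `z`, after multiplication of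
column `k` by `h(u_k,z)`. -/
def affineRow (η β : ℂ) {m n : ℕ} (v : Fin m → ℂ) (u : Fin n → ℂ) (z : ℂ) (i : Fin m)
    (k : Fin n) : ℂ :=
  Complex.exp β * tt η (u k) (v i) * hh η (u k) z -
    tt η (v i) (u k) * ratioX η v u k * hh η z (u k)

/-- The matrix of `Ψ` with parameters `(v̄, z)` and `ū`, after multiplication of
column `k` by `h(u_k,z)`. -/
def clearedMatrix (η β : ℂ) {m : ℕ} (v : Fin m → ℂ) (u : Fin (m + 2) → ℂ) (z : ℂ) :
    Matrix (Fin (m + 2)) (Fin (m + 2)) ℂ :=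
  Matrix.of (Fin.snoc (α := fun _ => Fin (m + 2) → ℂ)
    (Fin.snoc (α := fun _ => Fin (m + 2) → ℂ) (affineRow η β v u z)
      (fun k => gg η (u k) z * (Complex.exp β + ratioX η v u k)))
    (ratioY η v u))

/-- The minors of `clearedMatrix` along the row of the parameter `z`. -/
def clearedMinor (η β : ℂ) {m : ℕ} (v : Fin m → ℂ) (u : Fin (m + 2) → ℂ) (z : ℂ)
    (k : Fin (m + 2)) : ℂ :=
  Matrix.det (Matrix.of (Fin.snoc (α := fun _ => Fin (m + 1) → ℂ)
    (fun i l => affineRow η β v u z i (k.succAbove l))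
    (fun l => ratioY η v u (k.succAbove l))))

theorem Psi_eq_det_snoc (η β : ℂ) {m : ℕ} (v : Fin m → ℂ) (u : Fin (m + 1) → ℂ) :
    Psi η β m v u = Delta' η v * Delta η u * (∏ a, ∏ b, hh η (u a) (v b)) *
      Matrix.det (Matrix.of (Fin.snoc (α := fun _ => Fin (m + 1) → ℂ)
        (fun i k => Complex.exp β * tt η (u k) (v i) - tt η (v i) (u k) * ratioX η v u k)
        (ratioY η v u))) := by
  rw [Psi]
  congr 2
  ext r k
  induction r using Fin.lastCases with
  | last => simp [ratioY]
  | cast i => simp [ratioX, mul_div_assoc]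

theorem det_clearedMatrix (η β : ℂ) {m : ℕ} (v : Fin m → ℂ) (u : Fin (m + 2) → ℂ) (z : ℂ) :
    (clearedMatrix η β v u z).det = ∑ k : Fin (m + 2), (-1) ^ (m + k : ℕ) *
      (gg η (u k) z * (Complex.exp β + ratioX η v u k)) * clearedMinor η β v u z k := by
  rw [Matrix.det_succ_row _ (Fin.last m).castSucc]
  refine Finset.sum_congr rfl fun k _ => ?_
  congr 1
  · simp [clearedMatrix]
  · rw [clearedMinor]
    congr 1
    ext r l
    induction r using Fin.lastCases with
    | last => simp [clearedMatrix]
    | cast i => simp [clearedMatrix]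

theorem exists_polynomial_eval_eq_clearedMinor (η β : ℂ) {m : ℕ} (v : Fin m → ℂ)
    (u : Fin (m + 2) → ℂ) (k : Fin (m + 2)) :
    ∃ P : Polynomial ℂ, P.natDegree ≤ m ∧ ∀ z, P.eval z = clearedMinor η β v u z k := by
  let A : Fin m → Fin (m + 2) → ℂ := fun i k => Complex.exp β * tt η (u k) (v i) / η
  let B : Fin m → Fin (m + 2) → ℂ := fun i k => tt η (v i) (u k) * ratioX η v u k / η
  obtain ⟨P, hP, hPe⟩ := exists_polynomial_eval_eq_det
    (fun i l => -A i (k.succAbove l) - B i (k.succAbove l))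
    (fun i l => A i (k.succAbove l) * (u (k.succAbove l) + η) -
      B i (k.succAbove l) * (η - u (k.succAbove l)))
    (fun l => ratioY η v u (k.succAbove l))
  refine ⟨P, hP, fun z => ?_⟩
  rw [hPe, clearedMinor]
  congr 3
  ext i l
  simp only [affineRow, hh, A, B]
  ring

theorem hh_ne_zero {η x y : ℂ} (hη : η ≠ 0) (h : x - y ≠ -η) : hh η x y ≠ 0 :=
  div_ne_zero (fun h0 => h (eq_neg_of_add_eq_zero_left h0)) hη

theorem tt_mul_hh {η x y : ℂ} (hη : η ≠ 0) (h : x - y ≠ -η) :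
    tt η x y * hh η x y = gg η x y := by
  have h1 : x - y + η ≠ 0 := fun h0 => h (eq_neg_of_add_eq_zero_left h0)
  rw [tt, hh, gg]
  by_cases hxy : x - y = 0
  · simp [hxy]
  · field_simp

theorem gg_mul_hh {η : ℂ} (hη : η ≠ 0) (x y : ℂ) : gg η x y * hh η x y = ff η x y := by
  rw [gg, hh, ff]
  field_simp

theorem hh_self {η : ℂ} (hη : η ≠ 0) (x : ℂ) : hh η x x = 1 := by
  simp [hh, hη]

theorem affineRow_eq_gg {η β : ℂ} (hη : η ≠ 0) {m n : ℕ} (v : Fin m → ℂ) (u : Fin n → ℂ)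
    (i : Fin m) (k : Fin n) (h : u k - v i ≠ η ∧ u k - v i ≠ -η) :
    affineRow η β v u (v i) i k = gg η (u k) (v i) * (Complex.exp β + ratioX η v u k) := by
  have h1 := tt_mul_hh hη h.2
  have h2 := tt_mul_hh (x := v i) (y := u k) hη fun h0 => h.1 (by linear_combination -h0)
  rw [gg_swap] at h2
  rw [affineRow]
  linear_combination Complex.exp β * h1 - ratioX η v u k * h2

theorem det_clearedMatrix_eq_zero {η β : ℂ} (hη : η ≠ 0) {m : ℕ} (v : Fin m → ℂ)
    (u : Fin (m + 2) → ℂ) (huvη : ∀ j k, u k - v j ≠ η ∧ u k - v j ≠ -η) (i : Fin m) :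
    (clearedMatrix η β v u (v i)).det = 0 := by
  refine Matrix.det_zero_of_row_eq (i := i.castSucc.castSucc) (j := (Fin.last m).castSucc)
    (fun h => (Fin.castSucc_lt_last i).ne (Fin.castSucc_injective _ h)) ?_
  ext k
  simp [clearedMatrix, affineRow_eq_gg hη v u i k (huvη i k)]

theorem Psi_succ_eq_clearedMatrix {η β : ℂ} (hη : η ≠ 0) {m : ℕ} (v : Fin (m + 1) → ℂ)
    (u : Fin (m + 2) → ℂ) (huvη : ∀ j k, u k - v j ≠ η ∧ u k - v j ≠ -η) :
    Psi η β (m + 1) v u = Delta' η v * Delta η u *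
      (∏ a, ∏ b : Fin m, hh η (u a) (v b.castSucc)) *
        (clearedMatrix η β (v ∘ Fin.castSucc) u (v (Fin.last m))).det := by
  set z := v (Fin.last m) with hz
  have hne : ∀ k, hh η (u k) z ≠ 0 := fun k => hh_ne_zero hη (huvη _ k).2
  have hX : ∀ k, hh η (u k) z * ratioX η v u k =
      ratioX η (v ∘ Fin.castSucc) u k * hh η z (u k) := fun k => by
    have := hne k
    simp only [ratioX, Fin.prod_univ_castSucc (n := m), ← hz, Function.comp_apply]
    field_simp
  rw [Psi_eq_det_snoc]
  simp only [Fin.prod_univ_castSucc (n := m), Finset.prod_mul_distrib]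
  rw [mul_assoc, mul_assoc _ _ (Matrix.det _), mul_assoc _ _ (Matrix.det _), ← Matrix.det_mul_row]
  congr 3
  ext r k
  induction r using Fin.lastCases with
  | last =>
    have := hne k
    simp only [clearedMatrix, Matrix.of_apply, Fin.snoc_last, ratioY,
      Fin.prod_univ_castSucc (n := m), ← hz, Function.comp_apply]
    rw [← div_div, mul_div_cancel₀ _ this]
  | cast r =>
    simp only [clearedMatrix, Matrix.of_apply, Fin.snoc_castSucc]
    induction r using Fin.lastCases with
    | last =>
      simp only [Fin.snoc_last, ← hz]
      have h1 := tt_mul_hh hη (huvη (Fin.last m) k).2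
      have h2 := tt_mul_hh (x := z) (y := u k) hη fun h0 =>
        (huvη (Fin.last m) k).1 (by linear_combination -h0)
      rw [gg_swap] at h2
      linear_combination Complex.exp β * h1 - tt η z (u k) * hX k -
        ratioX η (v ∘ Fin.castSucc) u k * h2
    | cast i =>
      simp only [Fin.snoc_castSucc, affineRow, Function.comp_apply]
      linear_combination -tt η (v i.castSucc) (u k) * hX k

theorem clearedMinor_self {η β : ℂ} (hη : η ≠ 0) {m : ℕ} (v : Fin m → ℂ)
    (u : Fin (m + 2) → ℂ) (huη : ∀ a b, a ≠ b → u a - u b ≠ η ∧ u a - u b ≠ -η)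
    (k : Fin (m + 2)) :
    clearedMinor η β v u (u k) k = (∏ l, hh η (u (k.succAbove l)) (u k)) *
      Matrix.det (Matrix.of (Fin.snoc (α := fun _ => Fin (m + 1) → ℂ)
        (fun i l => Complex.exp β * tt η ((u ∘ k.succAbove) l) (v i) -
          tt η (v i) ((u ∘ k.succAbove) l) * ratioX η v (u ∘ k.succAbove) l)
        (ratioY η v (u ∘ k.succAbove)))) := by
  rw [clearedMinor, ← Matrix.det_mul_row]
  congr 1
  ext r l
  induction r using Fin.lastCases with
  | last =>
    simp only [Matrix.of_apply, Fin.snoc_last, ratioY, Function.comp_apply]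
    rw [Fin.prod_univ_succAbove _ k, mul_div_assoc]
  | cast i =>
    simp only [Matrix.of_apply, Fin.snoc_castSucc, affineRow, Function.comp_apply]
    have hne : hh η (u k) (u (k.succAbove l)) ≠ 0 :=
      hh_ne_zero hη (huη _ _ (Fin.succAbove_ne k l).symm).2
    have hX : ratioX η v u (k.succAbove l) * hh η (u k) (u (k.succAbove l)) =
        hh η (u (k.succAbove l)) (u k) * ratioX η v (u ∘ k.succAbove) l := by
      simp only [ratioX, Function.comp_apply]
      rw [Fin.prod_univ_succAbove (fun a => hh η (u (k.succAbove l)) (u a)) k,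
        Fin.prod_univ_succAbove (fun a => hh η (u a) (u (k.succAbove l))) k]
      field_simp
    linear_combination -tt η (v i) (u (k.succAbove l)) * hX

/-- The scalar factor of the `j`-th term of the recursion. -/
theorem recursion_coefficient {η : ℂ} (E : ℂ) (hη : η ≠ 0) {m : ℕ} (v : Fin m → ℂ)
    (u : Fin (m + 2) → ℂ) (huη : ∀ a b, a ≠ b → u a - u b ≠ η ∧ u a - u b ≠ -η)
    (huvη : ∀ j k, u k - v j ≠ η ∧ u k - v j ≠ -η) (j : Fin (m + 2)) :
    (∏ l, ff η (u (j.succAbove l)) (u j)) * (∏ i, ff η (u j) (v i)) *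
        (E + ratioX η v u j) =
      E * (∏ l, ff η (u (j.succAbove l)) (u j)) * (∏ i, ff η (u j) (v i)) -
        (∏ l, ff η (u j) (u (j.succAbove l))) * (∏ i, ff η (v i) (u j)) := by
  have hsign : ∀ (n : ℕ) (x : ℂ) (w : Fin n → ℂ),
      ∏ l, gg η x (w l) = (-1) ^ n * ∏ l, gg η (w l) x := fun n x w => by
    rw [Finset.prod_congr rfl fun l _ => gg_swap η x (w l), Finset.prod_neg]
    simp
  have h1 : ∏ l, hh η (u (j.succAbove l)) (u j) ≠ 0 := Finset.prod_ne_zero_iff.2 fun l _ =>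
    hh_ne_zero hη (huη _ _ (Fin.succAbove_ne j l)).2
  have h2 : ∏ i, hh η (u j) (v i) ≠ 0 := Finset.prod_ne_zero_iff.2 fun i _ =>
    hh_ne_zero hη (huvη i j).2
  have hX : ratioX η v u j =
      ((∏ l, hh η (u j) (u (j.succAbove l))) * ∏ i, hh η (v i) (u j)) /
        ((∏ l, hh η (u (j.succAbove l)) (u j)) * ∏ i, hh η (u j) (v i)) := by
    rw [ratioX, Fin.prod_univ_succAbove (fun a => hh η (u j) (u a)) j,
      Fin.prod_univ_succAbove (fun a => hh η (u a) (u j)) j, hh_self hη, one_mul, one_mul]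
  simp only [hX, ← gg_mul_hh hη, Finset.prod_mul_distrib]
  rw [hsign m (u j) v, hsign (m + 1) (u j) fun l => u (j.succAbove l), pow_succ]
  field_simp
  ring

/-- the recursion for `Ψ_N` obtained by expanding over the poles at
`v_{N−1} = u_j` (here `N = m + 2`). -/
theorem stmt6 (η β : ℂ) (hη : η ≠ 0) (m : ℕ)
    (u : Fin (m + 2) → ℂ) (v : Fin (m + 1) → ℂ)
    (hu : Function.Injective u) (hv : Function.Injective v)
    (huv : ∀ j k, u k ≠ v j)
    (huη : ∀ a b, a ≠ b → u a - u b ≠ η ∧ u a - u b ≠ -η)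
    (huvη : ∀ j k, u k - v j ≠ η ∧ u k - v j ≠ -η) :
    Psi η β (m + 1) v u =
      ∑ j : Fin (m + 2),
        gg η (u j) (v (Fin.last m)) *
          (Complex.exp β * (∏ k : Fin (m + 1), ff η (u (j.succAbove k)) (u j)) *
              (∏ k : Fin m, ff η (u j) (v k.castSucc)) -
            (∏ k : Fin (m + 1), ff η (u j) (u (j.succAbove k))) *
              (∏ k : Fin m, ff η (v k.castSucc) (u j))) *
          Psi η β m (v ∘ Fin.castSucc) (u ∘ j.succAbove) := by
  set z := v (Fin.last m) with hz
  set v' : Fin m → ℂ := v ∘ Fin.castSucc with hv'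
  have hvinj : Function.Injective v' := hv.comp (Fin.castSucc_injective m)
  have huvη' : ∀ j k, u k - v' j ≠ η ∧ u k - v' j ≠ -η := fun j k => huvη _ k
  choose Q hQdeg hQ using exists_polynomial_eval_eq_clearedMinor η β v' u
  let c : Fin (m + 2) → ℂ := fun k =>
    (-1) ^ (m + k : ℕ) * η * (Complex.exp β + ratioX η v' u k)
  have hdet : ∀ x, (clearedMatrix η β v' u x).det =
      ∑ k, (Polynomial.C (c k) * Q k).eval x / (u k - x) := fun x => by
    rw [det_clearedMatrix]
    refine Finset.sum_congr rfl fun k _ => ?_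
    rw [Polynomial.eval_mul, Polynomial.eval_C, hQ, gg]
    simp only [c]
    ring
  have hsum := sum_eval_div_sub_eq u v' hvinj (fun i k => huv _ k)
    (fun k => Polynomial.C (c k) * Q k)
    (fun k => (Polynomial.natDegree_C_mul_le _ _).trans (hQdeg k))
    (fun i => by rw [← hdet, det_clearedMatrix_eq_zero hη v' u huvη' i]) z
    (fun k => huv _ k)
  rw [← hdet] at hsum
  have hW : ∏ i, (v' i - z) ≠ 0 := Finset.prod_ne_zero_iff.2 fun i _ =>
    sub_ne_zero.2 (hv.ne (Fin.castSucc_lt_last i).ne)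
  have hgW : ∀ x, ∏ i, gg η (v' i) x = η ^ m / ∏ i, (v' i - x) := fun x => by
    simp [gg, Finset.prod_div_distrib]
  rw [Psi_succ_eq_clearedMatrix hη v u huvη, ← hz, ← hv', hsum, Delta'_eq_castSucc, ← hz, ← hv']
  have hcancel : (∏ l : Fin m, gg η (v l.castSucc) z) * ∏ i, (v' i - z) = η ^ m := by
    rw [← div_mul_cancel₀ (η ^ m) hW, ← hgW]
    rfl
  calc _ = Delta' η v' * Delta η u * (∏ a, ∏ b : Fin m, hh η (u a) (v' b)) *
        (((∏ l : Fin m, gg η (v l.castSucc) z) * ∏ i, (v' i - z)) *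
          ∑ k, (Polynomial.C (c k) * Q k).eval (u k) /
            ((∏ i, (v' i - u k)) * (u k - z))) := by
        simp only [hv', Function.comp_apply]
        ring
    _ = _ := by
        rw [hcancel, Finset.mul_sum, Finset.mul_sum]
        refine Finset.sum_congr rfl fun j _ => ?_
        have hcoef := recursion_coefficient (Complex.exp β) hη v' u huη huvη' j
        have hgsign : η ^ m / (∏ i, (v' i - u j)) = (-1) ^ m * ∏ i, gg η (u j) (v' i) := by
          rw [← hgW, Finset.prod_congr rfl fun i _ => gg_swap η (v' i) (u j), Finset.prod_neg]
          simp
        have hv'' : ∀ k : Fin m, v k.castSucc = v' k := fun _ => rfl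
        simp only [hv'']
        rw [← hcoef, Psi_eq_det_snoc, Polynomial.eval_mul, Polynomial.eval_C, hQ,
          clearedMinor_self hη v' u huη, Delta_eq_succAbove η u j,
          Fin.prod_univ_succAbove (fun a => ∏ b, hh η (u a) (v' b)) j]
        simp only [← gg_mul_hh hη, Finset.prod_mul_distrib, c, Function.comp_apply]
        rw [pow_add]
        have hs : ((-1 : ℂ) ^ m) * (-1) ^ m = 1 := by rw [← mul_pow]; simp
        have hs' : ((-1 : ℂ) ^ (j : ℕ)) * (-1) ^ (j : ℕ) = 1 := by rw [← mul_pow]; simp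
        rw [show gg η (u j) z = η / (u j - z) from rfl]
        rw [div_eq_mul_inv] at hgsign
        rw [div_eq_mul_inv, div_eq_mul_inv, mul_inv]
        generalize (-1 : ℂ) ^ m = s at *
        generalize (-1 : ℂ) ^ (j : ℕ) = s' at *
        generalize (∏ i, (v' i - u j))⁻¹ = w at *
        generalize Matrix.det (n := Fin (m + 1)) (R := ℂ) _ = D at *
        let K := η * (u j - z)⁻¹ * (∏ l, gg η (u (j.succAbove l)) (u j)) *
          (∏ l, hh η (u (j.succAbove l)) (u j)) * (∏ i, hh η (u j) (v' i)) *
          (Complex.exp β + ratioX η v' u j) * Delta' η v' * Delta η (u ∘ j.succAbove) *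
          (∏ a, ∏ b, hh η (u (j.succAbove a)) (v' b)) * D
        have hss : s' * s' * (s * s) = 1 := by rw [hs, hs', one_mul]
        linear_combination K * s * s' * s' * hgsign + K * (∏ i, gg η (u j) (v' i)) * hss
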